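/- Preservation of no orphan messages: if neither RS(S1) nor RS(S2) contains an orphan-message configuration, then RS(S) contains no orphan-message configuration, where S = S1 ⋈_{H,K} S2 is the composed system. -/

import Mathlib

/- Common formalization of Communicating Finite State Machines (CFSMs),
communicating systems, gateways and their composition, following
"Global Types with Internal Delegation" / GTIR paper definitions. -/

namespace GTIR

/-- Polarity of an action: `!` (send) or `?` (receive). -/
inductive Pol : Type
  | bang
  | query
deriving DecidableEq

/-- Dual polarity: swap `!` and `?`. -/
def Pol.dual : Pol → Pol
  | .bang => .query
  | .query => .bang

/-- Actions over roles `R` and messages `A`: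
`snd s r a` is `sr!a` (s sends `a` to r), `rcv s r a` is `sr?a`
(r receives/consumes `a` sent by s). -/
inductive Act (R A : Type) : Type
  | snd : R → R → A → Act R A
  | rcv : R → R → A → Act R A

/-- The action is a send action. -/
def Act.isSend {R A : Type} : Act R A → Prop
  | .snd _ _ _ => True
  | .rcv _ _ _ => False

/-- The action is a receive action. -/
def Act.isRecv {R A : Type} : Act R A → Prop
  | .snd _ _ _ => False
  | .rcv _ _ _ => True

/-- Erase the channel name of an action: `pq!a ↦ !a`, `pq?a ↦ ?a`. -/
def Act.noC {R A : Type} : Act R A → Pol × A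
  | .snd _ _ a => (.bang, a)
  | .rcv _ _ a => (.query, a)

/-- The dual of a word over `{!,?} × A`: swap `!` and `?` pointwise. -/
def dualWord {A : Type} (w : List (Pol × A)) : List (Pol × A) :=
  w.map fun x => (x.1.dual, x.2)

/-- Universal state type: base states from `B`, plus arbitrarily nested fresh
"hat" states (one for each transition) used by the gateway construction. -/
inductive St (R A B : Type) : Type
  | base : B → St R A B
  | hat : St R A B → Act R A → St R A B → St R A B

/-- A communicating finite state machine over roles `R` and messages `A`,
with states taken from `St R A B`: an initial state together with a
transition relation. -/
structure CFSM (R A B : Type) where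
  init : St R A B
  delta : Set (St R A B × Act R A × St R A B)

namespace CFSM

variable {R A B : Type}

/-- A state is final if it has no outgoing transition. -/
def Final (M : CFSM R A B) (q : St R A B) : Prop :=
  ∀ l q', (q, l, q') ∉ M.delta

/-- A sending state: non-final, and all outgoing transitions are sends. -/
def Sending (M : CFSM R A B) (q : St R A B) : Prop :=
  (∃ l q', (q, l, q') ∈ M.delta) ∧ ∀ l q', (q, l, q') ∈ M.delta → l.isSend

/-- A receiving state: non-final, and all outgoing transitions are receives. -/
def Receiving (M : CFSM R A B) (q : St R A B) : Prop :=
  (∃ l q', (q, l, q') ∈ M.delta) ∧ ∀ l q', (q, l, q') ∈ M.delta → l.isRecv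

/-- A mixed state: it has both an outgoing send and an outgoing receive. -/
def Mixed (M : CFSM R A B) (q : St R A B) : Prop :=
  (∃ l q', (q, l, q') ∈ M.delta ∧ l.isSend) ∧
  (∃ l q', (q, l, q') ∈ M.delta ∧ l.isRecv)

/-- `M` has no mixed states. -/
def NoMixed (M : CFSM R A B) : Prop := ∀ q, ¬ M.Mixed q

/-- `?`-determinism: two receives of the same message from the same state
(possibly on different channels) have the same target. -/
def QDet (M : CFSM R A B) : Prop :=
  ∀ q a s r s' r' q' q'', (q, Act.rcv s r a, q') ∈ M.delta →
    (q, Act.rcv s' r' a, q'') ∈ M.delta → q' = q''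

/-- `!`-determinism: two sends of the same message from the same state
(possibly on different channels) have the same target. -/
def BDet (M : CFSM R A B) : Prop :=
  ∀ q a s r s' r' q' q'', (q, Act.snd s r a, q') ∈ M.delta →
    (q, Act.snd s' r' a, q'') ∈ M.delta → q' = q''

/-- `?!`-determinism. -/
def IODet (M : CFSM R A B) : Prop := M.QDet ∧ M.BDet

/-- Accepting runs from a given state (every state is accepting). -/
inductive Accepts (M : CFSM R A B) : St R A B → List (Act R A) → Prop
  | nil (q : St R A B) : Accepts M q []
  | cons {q : St R A B} {l : Act R A} {q' : St R A B} {φ : List (Act R A)} :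
      (q, l, q') ∈ M.delta → Accepts M q' φ → Accepts M q (l :: φ)

/-- The language of `M` over `Act`. -/
def lang (M : CFSM R A B) : Set (List (Act R A)) := {φ | M.Accepts M.init φ}

/-- The language of `M` with channel names erased. -/
def langNoC (M : CFSM R A B) : Set (List (Pol × A)) :=
  (fun φ => φ.map Act.noC) '' M.lang

/-- Compatibility `M ↔ M'`: the channel-erased language of `M` is the set of
duals of the channel-erased language of `M'`; moreover neither machine has a
mixed state and both are `?!`-deterministic. -/
def Compat (M M' : CFSM R A B) : Prop :=
  M.langNoC = dualWord '' M'.langNoC ∧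
  M.NoMixed ∧ M'.NoMixed ∧ M.IODet ∧ M'.IODet

/-- The machine of role `p` over the role set `P`: every transition label is
an action of `p` (a send `pr!a` or a receive `rp?a`) with partner `r ∈ P`. -/
def ActsFor (M : CFSM R A B) (p : R) (P : Set R) : Prop :=
  ∀ q l q', (q, l, q') ∈ M.delta →
    ∃ r a, r ∈ P ∧ r ≠ p ∧ (l = Act.snd p r a ∨ l = Act.rcv r p a)

/-- All states occurring in `M` are base states; this guarantees that the
intermediate "hat" states of the gateway construction are fresh for `M`. -/
def HatFree (M : CFSM R A B) : Prop :=
  (∃ b, M.init = St.base b) ∧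
  ∀ q l q', (q, l, q') ∈ M.delta →
    (∃ b, q = St.base b) ∧ (∃ b, q' = St.base b)

/-- The set `Q̂` of fresh intermediate gateway states of `M`
(one for each transition of `M`). -/
def hatStates (M : CFSM R A B) : Set (St R A B) :=
  {x | ∃ q l q', (q, l, q') ∈ M.delta ∧ x = St.hat q l q'}

/-- The gateway `gw(M_H, K)` of the machine `M` of role `H` towards role `K`:
each transition `t = (q, Hs!a, q')` of `M` is replaced by
`(q, KH?a, q̂_t)` and `(q̂_t, Hs!a, q')`, and each transition
`t = (q, sH?a, q')` of `M` is replaced by `(q, sH?a, q̂_t)` and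
`(q̂_t, HK!a, q')`. -/
def gw (M : CFSM R A B) (H K : R) : CFSM R A B where
  init := M.init
  delta :=
    {x | ∃ q s a q', (q, Act.snd H s a, q') ∈ M.delta ∧
      (x = (q, Act.rcv K H a, St.hat q (Act.snd H s a) q') ∨
       x = (St.hat q (Act.snd H s a) q', Act.snd H s a, q'))} ∪
    {x | ∃ q s a q', (q, Act.rcv s H a, q') ∈ M.delta ∧
      (x = (q, Act.rcv s H a, St.hat q (Act.rcv s H a) q') ∨
       x = (St.hat q (Act.rcv s H a) q', Act.snd H K a, q'))}

end CFSM

/-- A communicating system: a set of roles together with a CFSM for each role. -/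
structure CS (R A B : Type) where
  roles : Set R
  mach : R → CFSM R A B

namespace CS

variable {R A B : Type}

/-- Well-formedness: the machine of each role `p` of the system only carries
actions of `p` with partners among the system's roles. -/
def WF (S : CS R A B) : Prop :=
  ∀ p ∈ S.roles, (S.mach p).ActsFor p S.roles

/-- Each machine of the system has a finite transition relation
(hence finitely many relevant states). -/
def FiniteSys (S : CS R A B) : Prop :=
  ∀ p ∈ S.roles, (S.mach p).delta.Finite

open scoped Classical in
/-- Composition `S1 ⋈_{H,K} S2`: the union of the two systems, where the
machines of the interface roles `H` and `K` are replaced by the gateways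
`gw(M¹_H, K)` and `gw(M²_K, H)`. -/
noncomputable def compose (S1 S2 : CS R A B) (H K : R) : CS R A B where
  roles := S1.roles ∪ S2.roles
  mach := fun p =>
    if p = H then (S1.mach H).gw H K
    else if p = K then (S2.mach K).gw K H
    else if p ∈ S1.roles then S1.mach p
    else S2.mach p

end CS

/-- A configuration: a local state for every role and a buffer (word over the
messages) for every ordered channel. -/
structure Config (R A B : Type) where
  st : R → St R A B
  buf : R → R → List A

/-- The initial configuration(s) of a system: every machine of the system is
in its initial state and all the system's buffers are empty. -/
def InitConf {R A B : Type} (S : CS R A B) (c : Config R A B) : Prop :=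
  (∀ p ∈ S.roles, c.st p = (S.mach p).init) ∧
  (∀ p ∈ S.roles, ∀ q ∈ S.roles, c.buf p q = [])

/-- One asynchronous step of system `S`, labelled by an action:
a send `sr!a` appends `a` to the buffer of channel `sr`, a receive `sr?a`
removes `a` from the front of the buffer of channel `sr`; everything else is
unchanged. -/
def Step {R A B : Type} (S : CS R A B) (c : Config R A B) :
    Act R A → Config R A B → Prop
  | .snd s r a, c' =>
      s ∈ S.roles ∧ (c.st s, Act.snd s r a, c'.st s) ∈ (S.mach s).delta ∧
      (∀ p, p ≠ s → c'.st p = c.st p) ∧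
      c'.buf s r = c.buf s r ++ [a] ∧
      (∀ p q, ¬(p = s ∧ q = r) → c'.buf p q = c.buf p q)
  | .rcv s r a, c' =>
      r ∈ S.roles ∧ (c.st r, Act.rcv s r a, c'.st r) ∈ (S.mach r).delta ∧
      (∀ p, p ≠ r → c'.st p = c.st p) ∧
      c.buf s r = a :: c'.buf s r ∧
      (∀ p q, ¬(p = s ∧ q = r) → c'.buf p q = c.buf p q)

/-- `RS(S)`: the configurations reachable from the initial configuration. -/
def Reach {R A B : Type} (S : CS R A B) (c : Config R A B) : Prop :=
  ∃ c₀, InitConf S c₀ ∧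
    Relation.ReflTransGen (fun x y => ∃ l, Step S x l y) c₀ c

/-- Deadlock configuration: all the system's buffers are empty and every
machine is in a receiving state. -/
def DeadlockConf {R A B : Type} (S : CS R A B) (c : Config R A B) : Prop :=
  (∀ p ∈ S.roles, ∀ q ∈ S.roles, c.buf p q = []) ∧
  ∀ p ∈ S.roles, (S.mach p).Receiving (c.st p)

/-- A system is deadlock-free if no reachable configuration is a deadlock. -/
def DeadlockFree {R A B : Type} (S : CS R A B) : Prop :=
  ∀ c, Reach S c → ¬ DeadlockConf S c

/-- Orphan-message configuration: every machine is in a final state but some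
buffer of the system is non-empty. -/
def OrphanConf {R A B : Type} (S : CS R A B) (c : Config R A B) : Prop :=
  (∀ p ∈ S.roles, (S.mach p).Final (c.st p)) ∧
  ∃ p ∈ S.roles, ∃ q ∈ S.roles, c.buf p q ≠ []

/-- Unspecified reception configuration: some machine is in a receiving state
but each of its expected input buffers is non-empty and starts with a message
it cannot receive. -/
def UnspecConf {R A B : Type} (S : CS R A B) (c : Config R A B) : Prop :=
  ∃ r ∈ S.roles, (S.mach r).Receiving (c.st r) ∧
    ∀ s a q', (c.st r, Act.rcv s r a, q') ∈ (S.mach r).delta →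
      c.buf s r ≠ [] ∧ ∀ w, c.buf s r ≠ a :: w

/-- A system is safe if no reachable configuration is a deadlock,
an orphan-message, or an unspecified reception configuration. -/
def Safe {R A B : Type} (S : CS R A B) : Prop :=
  ∀ c, Reach S c →
    ¬ DeadlockConf S c ∧ ¬ OrphanConf S c ∧ ¬ UnspecConf S c

end GTIR


namespace GTIR

variable {R A B : Type}

def Run (M : CFSM R A B) : St R A B → List (Pol × A) → St R A B → Prop
  | q, [], q' => q = q'
  | q, x :: w, q' => ∃ l q1, (q, l, q1) ∈ M.delta ∧ l.noC = x ∧ Run M q1 w q'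

theorem Run.snoc {M : CFSM R A B} {w : List (Pol × A)} : ∀ {q q1 q2 : St R A B} {l : Act R A},
    Run M q w q1 → (q1, l, q2) ∈ M.delta → Run M q (w ++ [l.noC]) q2 := by
  induction w with
  | nil =>
    intro q q1 q2 l h h'
    cases h
    exact ⟨l, q2, h', rfl, rfl⟩
  | cons x w ih =>
    rintro q q1 q2 l ⟨l0, q0, h0, e, h⟩ h'
    exact ⟨l0, q0, h0, e, ih h h'⟩

theorem Run.of_accepts {M : CFSM R A B} {q : St R A B} {φ : List (Act R A)}
    (h : M.Accepts q φ) : ∃ x, Run M q (φ.map Act.noC) x := by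
  induction h with
  | nil q => exact ⟨q, rfl⟩
  | cons h _ ih =>
    obtain ⟨x, hx⟩ := ih
    exact ⟨x, _, _, h, rfl, hx⟩

theorem Run.to_accepts {M : CFSM R A B} {w : List (Pol × A)} : ∀ {q x : St R A B},
    Run M q w x → ∃ φ, M.Accepts q φ ∧ φ.map Act.noC = w := by
  induction w with
  | nil => intro q x _; exact ⟨[], .nil _, rfl⟩
  | cons y w ih =>
    rintro q x ⟨l, q1, h, e, hr⟩
    obtain ⟨φ, h1, h2⟩ := ih hr
    exact ⟨l :: φ, .cons h h1, by simp [h2, e]⟩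

theorem mem_langNoC {M : CFSM R A B} {w : List (Pol × A)} :
    w ∈ M.langNoC ↔ ∃ x, Run M M.init w x := by
  constructor
  · rintro ⟨φ, h, rfl⟩
    exact Run.of_accepts h
  · rintro ⟨x, h⟩
    obtain ⟨φ, h1, h2⟩ := Run.to_accepts h
    exact ⟨φ, h1, h2⟩

theorem dual_dual (w : List (Pol × A)) : dualWord (dualWord w) = w := by
  induction w with
  | nil => rfl
  | cons x w ih =>
    obtain ⟨p, a⟩ := x
    simp only [dualWord, List.map_cons] at ih ⊢
    rw [ih]
    cases p <;> rfl

def recvs : List (Pol × A) → List A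
  | [] => []
  | (.bang, _) :: w => recvs w
  | (.query, a) :: w => a :: recvs w

def sends : List (Pol × A) → List A
  | [] => []
  | (.query, _) :: w => sends w
  | (.bang, a) :: w => a :: sends w

theorem recvs_append (w w' : List (Pol × A)) : recvs (w ++ w') = recvs w ++ recvs w' := by
  induction w with
  | nil => rfl
  | cons x w ih => obtain ⟨p, a⟩ := x; cases p <;> simp [recvs, ih]

theorem sends_append (w w' : List (Pol × A)) : sends (w ++ w') = sends w ++ sends w' := by
  induction w with
  | nil => rfl
  | cons x w ih => obtain ⟨p, a⟩ := x; cases p <;> simp [sends, ih]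

theorem det {M : CFSM R A B} (h : M.IODet) {q q1 q2 : St R A B} {l1 l2 : Act R A}
    (h1 : (q, l1, q1) ∈ M.delta) (h2 : (q, l2, q2) ∈ M.delta) (e : l1.noC = l2.noC) :
    q1 = q2 := by
  cases l1 <;> cases l2 <;> simp [Act.noC] at e
  · subst e; exact h.2 _ _ _ _ _ _ _ _ h1 h2
  · subst e; exact h.1 _ _ _ _ _ _ _ _ h1 h2

theorem no_mix {M : CFSM R A B} (h : M.NoMixed) {q q1 q2 : St R A B} {l1 l2 : Act R A} {a b : A}
    (h1 : (q, l1, q1) ∈ M.delta) (h2 : (q, l2, q2) ∈ M.delta) (e1 : l1.noC = (.bang, a))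
    (e2 : l2.noC = (.query, b)) : False := by
  cases l1 <;> cases l2 <;> simp [Act.noC] at e1 e2
  exact h q ⟨⟨_, _, h1, trivial⟩, ⟨_, _, h2, trivial⟩⟩

theorem words {M M' : CFSM R A B} (hd : M.IODet) (hd' : M'.IODet) (hm : M'.NoMixed)
    (φ1 : List (Pol × A)) : ∀ (q q' : St R A B) (φ2 : List (Pol × A)) (q1 q2 : St R A B)
    (u v : List A),
    (∀ w, (∃ x, Run M q w x) ↔ ∃ x, Run M' q' (dualWord w) x) →
    Run M q φ1 q1 → Run M' q' φ2 q2 → M.Final q1 → M'.Final q2 →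
    recvs φ1 = sends φ2 ++ u → recvs φ2 = sends φ1 ++ v → u = [] ∧ v = [] := by
  induction φ1 with
  | nil =>
    intro q q' φ2 q1 q2 u v hres r1 r2 f1 f2 e1 e2
    cases r1
    cases φ2 with
    | nil => 
      simp [recvs, sends] at e1 e2
      exact ⟨e1, e2⟩
    | cons x w =>
      obtain ⟨l, qq, h, e, -⟩ := r2
      have := (hres (dualWord [x])).2 ⟨qq, by rw [dual_dual]; exact ⟨l, qq, h, e, rfl⟩⟩
      obtain ⟨_, l', qq', h', -⟩ := this
      exact absurd h' (f1 _ _)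
  | cons y φ ih =>
    intro q q' φ2 q1 q2 u v hres r1 r2 f1 f2 e1 e2
    obtain ⟨l, qa, hl, el, r1⟩ := r1
    obtain ⟨_, l', qb, hl', el', -⟩ := (hres [y]).1 ⟨qa, l, qa, hl, el, rfl⟩
    cases φ2 with
    | nil => cases r2; exact absurd hl' (f2 _ _)
    | cons z φ' =>
      obtain ⟨m, qc, hz, ez, r2⟩ := r2
      have hzy : z = (y.1.dual, y.2) ∧ recvs φ = sends φ' ++ u ∧ recvs φ' = sends φ ++ v := by
        obtain ⟨p, a⟩ := y
        obtain ⟨p', b⟩ := z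
        cases p <;> cases p'
        · exact (no_mix hm hz hl' ez el').elim
        · simp [recvs, sends] at e1 e2
          simp [Pol.dual, e1, e2]
        · simp [recvs, sends] at e1 e2
          simp [Pol.dual, e1, e2]
        · exact (no_mix hm hl' hz el' ez).elim
      obtain ⟨ezy, e1, e2⟩ := hzy
      refine ih qa qc φ' q1 q2 u v ?_ r1 r2 f1 f2 e1 e2
      intro w
      constructor
      · rintro ⟨x, hx⟩
        obtain ⟨x', m', qd, hm', em', hx'⟩ := (hres (y :: w)).1 ⟨x, l, qa, hl, el, hx⟩
        have : qd = qc := det hd' hm' hz (by rw [em', ez, ezy])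
        subst this
        exact ⟨x', hx'⟩
      · rintro ⟨x, hx⟩
        obtain ⟨x', m', qd, hm', em', hx'⟩ :=
          (hres (y :: w)).2 ⟨x, m, qc, hz, by rw [ez, ezy], hx⟩
        have : qd = qa := det hd hm' hl (by rw [em', el])
        subst this
        exact ⟨x', hx'⟩

def projS : St R A B → St R A B
  | .base b => .base b
  | .hat q (.snd _ _ _) _ => q
  | .hat _ (.rcv _ _ _) q' => q'

theorem projS_snd (q q' : St R A B) (s r : R) (a : A) :
    projS (.hat q (.snd s r a) q') = q := rfl

theorem projS_rcv (q q' : St R A B) (s r : R) (a : A) :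
    projS (.hat q (.rcv s r a) q') = q' := rfl

def projI : St R A B → St R A B
  | .base b => .base b
  | .hat _ (.snd _ _ _) q' => q'
  | .hat q (.rcv _ _ _) _ => q

structure Side (S S1 S2 : CS R A B) (H K : R) : Prop where
  hH : H ∈ S1.roles
  hK : K ∈ S2.roles
  disj : ∀ p, p ∈ S1.roles → p ∈ S2.roles → False
  roles : ∀ p, p ∈ S.roles ↔ p ∈ S1.roles ∨ p ∈ S2.roles
  mH : S.mach H = (S1.mach H).gw H K
  mO : ∀ p ∈ S1.roles, p ≠ H → S.mach p = S1.mach p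
  wf : S1.WF
  hf : (S1.mach H).HatFree

open scoped Classical in
noncomputable def proj (S1 : CS R A B) (H : R) (c : Config R A B) : Config R A B where
  st := fun p => if p = H then projS (c.st H) else if p ∈ S1.roles then c.st p else
    (S1.mach p).init
  buf := fun p q => if p ∈ S1.roles ∧ q ∈ S1.roles then c.buf p q else []

theorem wf_snd {S : CS R A B} (h : S.WF) {p : R} (hp : p ∈ S.roles) {q q' : St R A B} {s r : R}
    {a : A} (ht : (q, Act.snd s r a, q') ∈ (S.mach p).delta) : r ∈ S.roles ∧ r ≠ p := by
  obtain ⟨r', a', h1, h2, h3 | h3⟩ := h p hp _ _ _ ht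
  · cases h3; exact ⟨h1, h2⟩
  · cases h3

theorem wf_rcv {S : CS R A B} (h : S.WF) {p : R} (hp : p ∈ S.roles) {q q' : St R A B} {s r : R}
    {a : A} (ht : (q, Act.rcv s r a, q') ∈ (S.mach p).delta) : s ∈ S.roles ∧ s ≠ p := by
  obtain ⟨r', a', h1, h2, h3 | h3⟩ := h p hp _ _ _ ht
  · cases h3
  · cases h3; exact ⟨h1, h2⟩

theorem projS_base {M : CFSM R A B} (hf : M.HatFree) {q q' : St R A B} {l : Act R A}
    (h : (q, l, q') ∈ M.delta) : projS q = q ∧ projS q' = q' ∧ projI q = q ∧ projI q' = q' := by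
  obtain ⟨⟨b, rfl⟩, ⟨b', rfl⟩⟩ := hf.2 _ _ _ h
  exact ⟨rfl, rfl, rfl, rfl⟩

theorem Config.ext' {c c' : Config R A B} (h : ∀ p, c.st p = c'.st p)
    (h' : ∀ p q, c.buf p q = c'.buf p q) : c = c' := by
  cases c; cases c'
  congr
  · exact funext h
  · exact funext fun p => funext fun q => h' p q

theorem gw_cases {M : CFSM R A B} {H K : R} {x y : St R A B} {l : Act R A}
    (h : (x, l, y) ∈ (M.gw H K).delta) :
    (∃ s a q', (x, Act.snd H s a, q') ∈ M.delta ∧ l = .rcv K H a ∧ y = .hat x (.snd H s a) q') ∨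
    (∃ q s a, (q, Act.snd H s a, y) ∈ M.delta ∧ l = .snd H s a ∧ x = .hat q (.snd H s a) y) ∨
    (∃ s a q', (x, Act.rcv s H a, q') ∈ M.delta ∧ l = .rcv s H a ∧ y = .hat x (.rcv s H a) q') ∨
    (∃ q s a, (q, Act.rcv s H a, y) ∈ M.delta ∧ l = .snd H K a ∧ x = .hat q (.rcv s H a) y) := by
  rcases h with ⟨q, s, a, q', h, e | e⟩ | ⟨q, s, a, q', h, e | e⟩ <;>
    simp only [Prod.mk.injEq] at e <;> obtain ⟨rfl, rfl, rfl⟩ := e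
  · exact .inl ⟨_, _, _, h, rfl, rfl⟩
  · exact .inr (.inl ⟨_, _, _, h, rfl, rfl⟩)
  · exact .inr (.inr (.inl ⟨_, _, _, h, rfl, rfl⟩))
  · exact .inr (.inr (.inr ⟨_, _, _, h, rfl, rfl⟩))

theorem proj_step {S S1 S2 : CS R A B} {H K : R} (sd : Side S S1 S2 H K)
    {c c' : Config R A B} {l : Act R A} (h : Step S c l c') :
    proj S1 H c = proj S1 H c' ∨ ∃ l, Step S1 (proj S1 H c) l (proj S1 H c') := by
  have hK1 : K ∉ S1.roles := fun h => sd.disj _ h sd.hK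
  have hH := sd.hH
  cases l with
  | snd s r a =>
    obtain ⟨hs, ht, hst, hb, hbo⟩ := h
    by_cases hs1 : s ∈ S1.roles
    · by_cases hsH : s = H
      · subst hsH
        rw [sd.mH] at ht
        rcases gw_cases ht with ⟨_, _, _, _, e, _⟩ | ⟨q, s', a', h, e, ex⟩ | ⟨_, _, _, _, e, _⟩ |
          ⟨q, s', a', h, e, ex⟩
        · cases e
        · cases e
          right
          have hr := wf_snd sd.wf hs1 h
          have hp := projS_base sd.hf h
          refine ⟨.snd s r a, hs1, ?_, ?_, ?_, ?_⟩
          · simp only [proj, if_true, ex, projS_snd, projS_rcv, hp.2.1]; exact h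
          · intro p hp; simp [proj, hp, hst p hp]
          · simp [proj, hs1, hr, hb]
          · intro p q hpq; simp [proj, hbo p q hpq]
        · cases e
        · cases e
          left
          have hp := projS_base sd.hf h
          apply Config.ext'
          · intro p
            by_cases hps : p = s
            · subst hps; simp [proj, ex, projS_snd, projS_rcv, hp]
            · simp [proj, hps, hst p hps]
          · intro p q
            by_cases hpq : p = s ∧ q = K
            · simp [proj, hpq, hK1]
            · simp [proj, hbo p q hpq]
      · right
        rw [sd.mO s hs1 hsH] at ht
        have hr := wf_snd sd.wf hs1 ht
        refine ⟨.snd s r a, hs1, ?_, ?_, ?_, ?_⟩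
        · simp only [proj, hsH, hs1, if_true, if_false]; exact ht
        · intro p hp
          by_cases hpH : p = H
          · subst hpH; simp [proj, hst p hp]
          · simp [proj, hpH, hst p hp]
        · simp [proj, hs1, hr, hb]
        · intro p q hpq; simp [proj, hbo p q hpq]
    · left
      have hsH : H ≠ s := fun e => hs1 (e ▸ hH)
      apply Config.ext'
      · intro p
        by_cases hps : p = s
        · subst hps; simp [proj, hs1, hsH.symm]
        · simp [proj, hst p hps, hst H hsH]
      · intro p q
        by_cases hpq : p = s ∧ q = r
        · simp [proj, hpq, hs1]
        · simp [proj, hbo p q hpq]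
  | rcv r s a =>
    obtain ⟨hs, ht, hst, hb, hbo⟩ := h
    by_cases hs1 : s ∈ S1.roles
    · by_cases hsH : s = H
      · subst hsH
        rw [sd.mH] at ht
        rcases gw_cases ht with ⟨s', a', q, h, e, ex⟩ | ⟨_, _, _, _, e, _⟩ | ⟨s', a', q, h, e, ex⟩ |
          ⟨_, _, _, _, e, _⟩
        · cases e
          left
          have hp := projS_base sd.hf h
          apply Config.ext'
          · intro p
            by_cases hps : p = s
            · subst hps; simp [proj, ex, projS_snd, projS_rcv, hp]
            · simp [proj, hps, hst p hps]
          · intro p q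
            by_cases hpq : p = K ∧ q = s
            · simp [proj, hpq, hK1]
            · simp [proj, hbo p q hpq]
        · cases e
        · cases e
          right
          have hr := wf_rcv sd.wf hs1 h
          have hp := projS_base sd.hf h
          refine ⟨.rcv r s a, hs1, ?_, ?_, ?_, ?_⟩
          · simp only [proj, if_true, ex, projS_snd, projS_rcv, hp.1]; exact h
          · intro p hp; simp [proj, hp, hst p hp]
          · simp [proj, hs1, hr, hb]
          · intro p q hpq; simp [proj, hbo p q hpq]
        · cases e
      · right
        rw [sd.mO s hs1 hsH] at ht
        have hr := wf_rcv sd.wf hs1 ht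
        refine ⟨.rcv r s a, hs1, ?_, ?_, ?_, ?_⟩
        · simp only [proj, hsH, hs1, if_true, if_false]; exact ht
        · intro p hp
          by_cases hpH : p = H
          · subst hpH; simp [proj, hst p hp]
          · simp [proj, hpH, hst p hp]
        · simp [proj, hs1, hr, hb]
        · intro p q hpq; simp [proj, hbo p q hpq]
    · left
      have hsH : H ≠ s := fun e => hs1 (e ▸ hH)
      apply Config.ext'
      · intro p
        by_cases hps : p = s
        · subst hps; simp [proj, hs1, hsH.symm]
        · simp [proj, hst p hps, hst H hsH]
      · intro p q
        by_cases hpq : p = r ∧ q = s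
        · simp [proj, hpq, hs1]
        · simp [proj, hbo p q hpq]

theorem init_st {S S1 S2 : CS R A B} {H K : R} (sd : Side S S1 S2 H K)
    {c : Config R A B} (h : InitConf S c) : c.st H = (S1.mach H).init := by
  rw [h.1 H ((sd.roles _).2 (.inl sd.hH)), sd.mH]; rfl

theorem proj_reach {S S1 S2 : CS R A B} {H K : R} (sd : Side S S1 S2 H K)
    {c : Config R A B} (h : Reach S c) : Reach S1 (proj S1 H c) := by
  obtain ⟨c0, hi, hr⟩ := h
  refine ⟨proj S1 H c0, ⟨?_, ?_⟩, ?_⟩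
  · intro p hp
    by_cases hpH : p = H
    · subst hpH
      obtain ⟨b, hb⟩ := sd.hf.1
      simp [proj, init_st sd hi, hb, projS]
    · simp [proj, hpH, hp, hi.1 p ((sd.roles _).2 (.inl hp)), sd.mO p hp hpH]
  · intro p hp q hq
    simp [proj, hp, hq, hi.2 p ((sd.roles _).2 (.inl hp)) q ((sd.roles _).2 (.inl hq))]
  · clear hi
    induction hr with
    | refl => exact .refl
    | tail _ hs ih =>
      obtain ⟨l, hs⟩ := hs
      rcases proj_step sd hs with e | h
      · rw [← e]; exact ih
      · exact ih.tail h

/-- Final states of the gateway are final (non-hat) states. -/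
theorem gw_final {M : CFSM R A B} {H K : R} {P : Set R} (ha : M.ActsFor H P) {q : St R A B}
    (h : (M.gw H K).Final q) : M.Final q := by
  intro l q' ht
  obtain ⟨r, a, -, -, rfl | rfl⟩ := ha _ _ _ ht
  · exact h _ _ (.inl ⟨_, _, _, _, ht, .inl rfl⟩)
  · exact h _ _ (.inr ⟨_, _, _, _, ht, .inl rfl⟩)

structure Inv (S1 S2 : CS R A B) (H K : R) (c : Config R A B) : Prop where
  b12 : ∀ p ∈ S1.roles, ∀ q ∈ S2.roles, ¬ (p = H ∧ q = K) → c.buf p q = []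
  b21 : ∀ p ∈ S1.roles, ∀ q ∈ S2.roles, ¬ (p = H ∧ q = K) → c.buf q p = []
  hat1 : (∃ b, c.st H = .base b) ∨ ∃ q l q', (q, l, q') ∈ (S1.mach H).delta ∧ c.st H = .hat q l q'
  hat2 : (∃ b, c.st K = .base b) ∨ ∃ q l q', (q, l, q') ∈ (S2.mach K).delta ∧ c.st K = .hat q l q'
  run : ∃ φ1 φ2, Run (S1.mach H) (S1.mach H).init φ1 (projI (c.st H)) ∧
    Run (S2.mach K) (S2.mach K).init φ2 (projI (c.st K)) ∧
    recvs φ1 = sends φ2 ++ c.buf H K ∧ recvs φ2 = sends φ1 ++ c.buf K H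

theorem Inv.symm {S1 S2 : CS R A B} {H K : R} {c : Config R A B} (h : Inv S1 S2 H K c) :
    Inv S2 S1 K H c := by
  obtain ⟨h1, h2, t1, t2, φ1, φ2, h3, h4, h5, h6⟩ := h
  exact ⟨fun p hp q hq e => h2 q hq p hp fun e' => e e'.symm,
    fun p hp q hq e => h1 q hq p hp fun e' => e e'.symm, t2, t1, φ2, φ1, h4, h3, h6, h5⟩

def actor : Act R A → R
  | .snd s _ _ => s
  | .rcv _ r _ => r

theorem inv_step {S S1 S2 : CS R A B} {H K : R} (sd : Side S S1 S2 H K)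
    {c c' : Config R A B} {l : Act R A} (hl : actor l ∈ S1.roles) (h : Step S c l c')
    (hi : Inv S1 S2 H K c) : Inv S1 S2 H K c' := by
  have hK1 : K ∉ S1.roles := fun h => sd.disj _ h sd.hK
  have hH := sd.hH
  have hKH : K ≠ H := fun e => hK1 (e ▸ hH)
  have hd := sd.disj
  obtain ⟨h1, h2, t1, t2, φ1, φ2, h3, h4, h5, h6⟩ := hi
  cases l with
  | snd s r a =>
    obtain ⟨hs, ht, hst, hb, hbo⟩ := h
    simp only [actor] at hl
    have hstK : c'.st K = c.st K := hst K fun e => hK1 (e ▸ hl)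
    have hKH' : c'.buf K H = c.buf K H := hbo _ _ fun e => hK1 (e.1 ▸ hl)
    have b21 : ∀ p ∈ S1.roles, ∀ q ∈ S2.roles, ¬ (p = H ∧ q = K) → c'.buf q p = [] := by
      intro p hp q hq e
      rw [hbo q p fun e => hd _ hl (e.1 ▸ hq)]; exact h2 p hp q hq e
    by_cases hr : r ∈ S1.roles
    · have hHK' : c'.buf H K = c.buf H K := hbo _ _ fun e => hK1 (e.2 ▸ hr)
      have key : projI (c'.st H) = projI (c.st H) ∧ ((∃ b, c'.st H = .base b) ∨
          ∃ q l q', (q, l, q') ∈ (S1.mach H).delta ∧ c'.st H = .hat q l q') := by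
        by_cases hsH : s = H
        · subst hsH
          rw [sd.mH] at ht
          rcases gw_cases ht with ⟨_, _, _, _, e, _⟩ | ⟨q, s', a', h, e, ex⟩ |
            ⟨_, _, _, _, e, _⟩ | ⟨q, s', a', h, e, ex⟩
          · cases e
          · cases e
            have hp := projS_base sd.hf h
            rw [ex]
            exact ⟨hp.2.2.2, .inl (sd.hf.2 _ _ _ h).2⟩
          · cases e
          · cases e
            exact absurd hr hK1
        · rw [hst H (Ne.symm hsH)]; exact ⟨rfl, t1⟩
      refine ⟨?_, b21, key.2, by rw [hstK]; exact t2, φ1, φ2, ?_, ?_, ?_, ?_⟩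
      · intro p hp q hq e
        rw [hbo p q fun e => hd _ hr (e.2 ▸ hq)]; exact h1 p hp q hq e
      · rw [key.1]; exact h3
      · rw [hstK]; exact h4
      · rw [hHK']; exact h5
      · rw [hKH']; exact h6
    · have hsH : s = H := by
        by_contra hsH
        rw [sd.mO s hl hsH] at ht
        exact hr (wf_snd sd.wf hl ht).1
      subst hsH
      rw [sd.mH] at ht
      rcases gw_cases ht with ⟨_, _, _, _, e, _⟩ | ⟨q, s', a', h, e, ex⟩ |
        ⟨_, _, _, _, e, _⟩ | ⟨q, s', a', h, e, ex⟩
      · cases e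
      · cases e
        exact absurd (wf_snd sd.wf hl h).1 hr
      · cases e
      · cases e
        have hp := projS_base sd.hf h
        refine ⟨?_, b21, .inl (sd.hf.2 _ _ _ h).2, by rw [hstK]; exact t2,
          φ1 ++ [(.query, a)], φ2, ?_, ?_, ?_, ?_⟩
        · intro p hp q hq e
          rw [hbo p q e]; exact h1 p hp q hq e
        · rw [hp.2.2.2]
          rw [ex] at h3
          exact h3.snoc h
        · rw [hstK]; exact h4
        · simp [recvs_append, recvs, hb, h5]
        · simp [sends_append, sends, hKH', h6]
  | rcv r s a =>
    obtain ⟨hs, ht, hst, hb, hbo⟩ := h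
    simp only [actor] at hl
    have hstK : c'.st K = c.st K := hst K fun e => hK1 (e ▸ hl)
    have hHK' : c'.buf H K = c.buf H K := hbo _ _ fun e => hK1 (e.2 ▸ hl)
    have b12 : ∀ p ∈ S1.roles, ∀ q ∈ S2.roles, ¬ (p = H ∧ q = K) → c'.buf p q = [] := by
      intro p hp q hq e
      rw [hbo p q fun e => hd _ hl (e.2 ▸ hq)]; exact h1 p hp q hq e
    by_cases hr : r ∈ S1.roles
    · have hKH' : c'.buf K H = c.buf K H := hbo _ _ fun e => hK1 (e.1 ▸ hr)
      have key : projI (c'.st H) = projI (c.st H) ∧ ((∃ b, c'.st H = .base b) ∨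
          ∃ q l q', (q, l, q') ∈ (S1.mach H).delta ∧ c'.st H = .hat q l q') := by
        by_cases hsH : s = H
        · subst hsH
          rw [sd.mH] at ht
          rcases gw_cases ht with ⟨s', a', q, h, e, ex⟩ | ⟨_, _, _, _, e, _⟩ |
            ⟨s', a', q, h, e, ex⟩ | ⟨_, _, _, _, e, _⟩
          · cases e
            exact absurd hr hK1
          · cases e
          · cases e
            have hp := projS_base sd.hf h
            rw [ex]
            exact ⟨hp.2.2.1.symm, .inr ⟨_, _, _, h, rfl⟩⟩
          · cases e
        · rw [hst H (Ne.symm hsH)]; exact ⟨rfl, t1⟩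
      refine ⟨b12, ?_, key.2, by rw [hstK]; exact t2, φ1, φ2, ?_, ?_, ?_, ?_⟩
      · intro p hp q hq e
        rw [hbo q p fun e => hd _ hr (e.1 ▸ hq)]; exact h2 p hp q hq e
      · rw [key.1]; exact h3
      · rw [hstK]; exact h4
      · rw [hHK']; exact h5
      · rw [hKH']; exact h6
    · have hsH : s = H := by
        by_contra hsH
        rw [sd.mO s hl hsH] at ht
        exact hr (wf_rcv sd.wf hl ht).1
      subst hsH
      rw [sd.mH] at ht
      rcases gw_cases ht with ⟨s', a', q, h, e, ex⟩ | ⟨_, _, _, _, e, _⟩ |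
        ⟨s', a', q, h, e, ex⟩ | ⟨_, _, _, _, e, _⟩
      · cases e
        have hp := projS_base sd.hf h
        refine ⟨b12, ?_, .inr ⟨_, _, _, h, ex⟩, by rw [hstK]; exact t2,
          φ1 ++ [(.bang, a)], φ2, ?_, ?_, ?_, ?_⟩
        · intro p hp q hq e
          rw [hbo q p fun e' => e e'.symm]; exact h2 p hp q hq e
        · rw [ex]
          rw [hp.2.2.1] at h3
          exact h3.snoc h
        · rw [hstK]; exact h4
        · simp [recvs_append, recvs, hHK', h5]
        · simp [sends_append, sends, h6, hb]
      · cases e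
      · cases e
        exact absurd (wf_rcv sd.wf hl h).1 hr
      · cases e

theorem actor_mem {S : CS R A B} {c c' : Config R A B} {l : Act R A} (h : Step S c l c') :
    actor l ∈ S.roles := by
  cases l <;> exact h.1

theorem inv_reach {S S1 S2 : CS R A B} {H K : R} (sd : Side S S1 S2 H K) (sd' : Side S S2 S1 K H)
    {c : Config R A B} (h : Reach S c) : Inv S1 S2 H K c := by
  obtain ⟨c0, hi, hr⟩ := h
  induction hr with
  | refl =>
    have r1 := fun p hp => (sd.roles p).2 (.inl hp)
    have r2 := fun p hp => (sd.roles p).2 (.inr hp)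
    obtain ⟨b, hb⟩ := sd.hf.1
    obtain ⟨b', hb'⟩ := sd'.hf.1
    refine ⟨fun p hp q hq _ => hi.2 _ (r1 _ hp) _ (r2 _ hq),
      fun p hp q hq _ => hi.2 _ (r2 _ hq) _ (r1 _ hp), .inl ⟨b, by rw [init_st sd hi, hb]⟩,
      .inl ⟨b', by rw [init_st sd' hi, hb']⟩, [], [], ?_, ?_, ?_, ?_⟩
    · rw [init_st sd hi, hb]; rfl
    · rw [init_st sd' hi, hb']; rfl
    · rw [hi.2 _ (r1 _ sd.hH) _ (r2 _ sd.hK)]; rfl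
    · rw [hi.2 _ (r2 _ sd.hK) _ (r1 _ sd.hH)]; rfl
  | tail _ hs ih =>
    obtain ⟨l, hs⟩ := hs
    rcases (sd.roles _).1 (actor_mem hs) with h | h
    · exact inv_step sd h hs ih
    · exact (inv_step sd' h hs ih.symm).symm

theorem final_base {S S1 S2 : CS R A B} {H K : R} (sd : Side S S1 S2 H K) {c : Config R A B}
    (hi : Inv S1 S2 H K c) (hf : (S.mach H).Final (c.st H)) :
    (S1.mach H).Final (c.st H) ∧ projS (c.st H) = c.st H ∧ projI (c.st H) = c.st H := by
  rw [sd.mH] at hf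
  refine ⟨gw_final (sd.wf H sd.hH) hf, ?_⟩
  rcases hi.hat1 with ⟨b, e⟩ | ⟨q, l, q', h, e⟩
  · rw [e]; exact ⟨rfl, rfl⟩
  · exfalso
    rw [e] at hf
    obtain ⟨r, a, -, -, rfl | rfl⟩ := sd.wf H sd.hH _ _ _ h
    · exact hf _ _ (.inl ⟨_, _, _, _, h, .inr rfl⟩)
    · exact hf _ _ (.inr ⟨_, _, _, _, h, .inr rfl⟩)

theorem side_empty {S S1 S2 : CS R A B} {H K : R} (sd : Side S S1 S2 H K) {c : Config R A B}
    (hr : Reach S c) (hi : Inv S1 S2 H K c) (hf : ∀ p ∈ S.roles, (S.mach p).Final (c.st p))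
    (h1 : ∀ c, Reach S1 c → ¬ OrphanConf S1 c) :
    ∀ p ∈ S1.roles, ∀ q ∈ S1.roles, c.buf p q = [] := by
  intro p hp q hq
  by_contra hne
  refine h1 _ (proj_reach sd hr) ⟨?_, p, hp, q, hq, by simpa [proj, hp, hq] using hne⟩
  intro p' hp'
  have hfp := hf p' ((sd.roles _).2 (.inl hp'))
  by_cases e : p' = H
  · subst e
    obtain ⟨h, e, -⟩ := final_base sd hi hfp
    simpa [proj, e] using h
  · rw [sd.mO _ hp' e] at hfp
    simpa [proj, e, hp'] using hfp

end GTIR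



open GTIR

/-- preservation of absence of orphan messages under
composition. -/
theorem stmt10_no_orphan_preserved
    {R A B : Type} [Finite R] [Finite A]
    (S1 S2 : CS R A B) (H K : R)
    (hH : H ∈ S1.roles) (hK : K ∈ S2.roles)
    (hdisj : S1.roles ∩ S2.roles = ∅)
    (hcompat : (S1.mach H).Compat (S2.mach K))
    (hwf1 : S1.WF) (hwf2 : S2.WF)
    (hfin1 : S1.FiniteSys) (hfin2 : S2.FiniteSys)
    (hhf1 : (S1.mach H).HatFree) (hhf2 : (S2.mach K).HatFree)
    (h1 : ∀ c, Reach S1 c → ¬ OrphanConf S1 c)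
    (h2 : ∀ c, Reach S2 c → ¬ OrphanConf S2 c) :
    ∀ c, Reach (CS.compose S1 S2 H K) c →
      ¬ OrphanConf (CS.compose S1 S2 H K) c := by
  have hd : ∀ p, p ∈ S1.roles → p ∈ S2.roles → False := fun p hp hq => by
    have : p ∈ S1.roles ∩ S2.roles := ⟨hp, hq⟩
    rw [hdisj] at this
    exact this
  have hKH : K ≠ H := fun e => hd H hH (e ▸ hK)
  have sd : Side (CS.compose S1 S2 H K) S1 S2 H K := by
    refine ⟨hH, hK, hd, fun p => Iff.rfl, by simp [CS.compose], ?_, hwf1, hhf1⟩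
    intro p hp e
    have : p ≠ K := fun e => hd p hp (e ▸ hK)
    simp [CS.compose, e, this, hp]
  have sd' : Side (CS.compose S1 S2 H K) S2 S1 K H := by
    refine ⟨hK, hH, fun p h h' => hd p h' h, fun p => Or.comm, by simp [CS.compose, hKH], ?_,
      hwf2, hhf2⟩
    intro p hp e
    have h1 : p ≠ H := fun e => hd p (e ▸ hH) hp
    have h2 : p ∉ S1.roles := fun h => hd p h hp
    simp [CS.compose, e, h1, h2]
  rintro c hr ⟨hf, p, hp, q, hq, hne⟩
  have hi := inv_reach sd sd' hr
  have e1 := side_empty sd hr hi hf h1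
  have e2 := side_empty sd' hr hi.symm hf h2
  have hHK : c.buf H K = [] ∧ c.buf K H = [] := by
    obtain ⟨φ1, φ2, r1, r2, w1, w2⟩ := hi.run
    obtain ⟨f1, -, p1⟩ := final_base sd hi (hf H (.inl hH))
    obtain ⟨f2, -, p2⟩ := final_base sd' hi.symm (hf K (.inr hK))
    rw [p1] at r1
    rw [p2] at r2
    obtain ⟨hl, -, hm', hD, hD'⟩ := hcompat
    refine words hD hD' hm' φ1 _ _ φ2 _ _ _ _ ?_ r1 r2 f1 f2 w1 w2
    intro w
    rw [← mem_langNoC, ← mem_langNoC, hl]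
    constructor
    · rintro ⟨w', h, rfl⟩
      rw [dual_dual]; exact h
    · intro h
      exact ⟨_, h, dual_dual w⟩
  apply hne
  rcases hp with hp | hp <;> rcases hq with hq | hq
  · exact e1 p hp q hq
  · by_cases e : p = H ∧ q = K
    · rw [e.1, e.2]; exact hHK.1
    · exact hi.b12 p hp q hq e
  · by_cases e : q = H ∧ p = K
    · rw [e.1, e.2]; exact hHK.2
    · exact hi.b21 q hq p hp e
  · exact e2 p hp q hq
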